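/- arXiv:1112.5019 — 10 statements merged into one kernel-verified Lean document; each statement's English description precedes it below -/
import Mathlib

section
/- Let f : ℝ² → ℂ be a Schwartz function and let l be a nonzero real number. Then |l| · ∫_{ℝ²} conj(F_w f(x)) · F_w f(l•x) dx = |l|⁻¹ · ∫_{ℝ²} conj(f(x)) · f(l⁻¹•x) dx, both integrals converging absolutely. (This is the isometry property ⟨F_w f, F_w f⟩ = ⟨f, f⟩_w of the twisted Fourier transform between the Hilbert modules E^w and E, in the case F = ℝ.) -/
open MeasureTheory

/-- The Fourier transform on `ℝ² = ℝ × ℝ`: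
`𝓕f(ξ) = ∫ f(x) e^{-2πi⟨x,ξ⟩} dx` with the Euclidean inner product. -/
noncomputable def fourierR2 (f : ℝ × ℝ → ℂ) (ξ : ℝ × ℝ) : ℂ :=
  ∫ x : ℝ × ℝ, f x * Complex.exp ((↑(-(2 * Real.pi * (x.1 * ξ.1 + x.2 * ξ.2))) : ℂ) * Complex.I)

/-- The twisted Fourier transform `F_w f(x) = 𝓕f(w⁻¹x) = 𝓕f((x₂, -x₁))`. -/
noncomputable def FwR (f : ℝ × ℝ → ℂ) (x : ℝ × ℝ) : ℂ :=
  fourierR2 f (x.2, -x.1)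

open scoped FourierTransform SchwartzMap

/-- The map `(x₁, x₂) ↦ (x₂, -x₁)` from `ℝ × ℝ` to the Euclidean plane. -/
noncomputable def rotationToLp : (ℝ × ℝ) ≃L[ℝ] WithLp 2 (ℝ × ℝ) :=
  ((ContinuousLinearEquiv.prodComm ℝ ℝ ℝ).trans
    ((ContinuousLinearEquiv.refl ℝ ℝ).prodCongr (ContinuousLinearEquiv.neg ℝ))).trans
    (WithLp.prodContinuousLinearEquiv 2 ℝ ℝ ℝ).symm

lemma rotationToLp_apply (x : ℝ × ℝ) : rotationToLp x = WithLp.toLp 2 (x.2, -x.1) := rfl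

lemma measurePreserving_rotationToLp : MeasurePreserving rotationToLp := by
  have h : MeasurePreserving (fun x : ℝ × ℝ => (x.2, -x.1)) :=
    ((MeasurePreserving.id volume).prod (Measure.measurePreserving_neg volume)).comp
      Measure.measurePreserving_swap
  exact (WithLp.volume_preserving_toLp ℝ ℝ).comp h

/-- A Schwartz function on `ℝ × ℝ` regarded as one on the Euclidean plane. -/
noncomputable def schwartzToLp (f : 𝓢(ℝ × ℝ, ℂ)) : 𝓢(WithLp 2 (ℝ × ℝ), ℂ) :=
  SchwartzMap.compCLMOfContinuousLinearEquiv ℂ (WithLp.prodContinuousLinearEquiv 2 ℝ ℝ ℝ) f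

lemma schwartzToLp_apply (f : 𝓢(ℝ × ℝ, ℂ)) (x : WithLp 2 (ℝ × ℝ)) :
    schwartzToLp f x = f x.ofLp := rfl

lemma fourier_schwartzToLp (f : 𝓢(ℝ × ℝ, ℂ)) (ξ : ℝ × ℝ) :
    𝓕 (schwartzToLp f) (WithLp.toLp 2 ξ) = fourierR2 f ξ := by
  rw [SchwartzMap.fourier_coe, Real.fourier_eq', fourierR2,
    ← (WithLp.volume_preserving_ofLp ℝ ℝ).integral_comp
      (WithLp.prodContinuousLinearEquiv 2 ℝ ℝ ℝ).toHomeomorph.measurableEmbedding]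
  congr 1 with x
  rw [schwartzToLp_apply, smul_eq_mul, mul_comm, WithLp.prod_inner_apply]
  simp [mul_comm]

lemma FwR_eq_fourier (f : 𝓢(ℝ × ℝ, ℂ)) (x : ℝ × ℝ) :
    FwR f x = 𝓕 (schwartzToLp f) (rotationToLp x) :=
  (fourier_schwartzToLp f _).symm

/-- The twisted Fourier transform of a Schwartz function, as a Schwartz function. -/
noncomputable def schwartzFwR (f : 𝓢(ℝ × ℝ, ℂ)) : 𝓢(ℝ × ℝ, ℂ) :=
  SchwartzMap.compCLMOfContinuousLinearEquiv ℂ rotationToLp (𝓕 (schwartzToLp f))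

lemma coe_schwartzFwR (f : 𝓢(ℝ × ℝ, ℂ)) : ⇑(schwartzFwR f) = FwR f :=
  funext fun x => (FwR_eq_fourier f x).symm

/-- Plancherel's theorem for the twisted Fourier transform. -/
lemma integral_conj_FwR_mul_FwR (f g : 𝓢(ℝ × ℝ, ℂ)) :
    ∫ x, (starRingEnd ℂ) (FwR f x) * FwR g x = ∫ x, (starRingEnd ℂ) (f x) * g x := by
  have h := SchwartzMap.integral_inner_fourier_fourier (schwartzToLp f) (schwartzToLp g)
  simp only [RCLike.inner_apply'] at h
  simp only [FwR_eq_fourier]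
  rw [measurePreserving_rotationToLp.integral_comp
    rotationToLp.toHomeomorph.measurableEmbedding
    (fun y => (starRingEnd ℂ) (𝓕 (schwartzToLp f) y) * 𝓕 (schwartzToLp g) y), h]
  exact (WithLp.volume_preserving_ofLp ℝ ℝ).integral_comp
    (WithLp.prodContinuousLinearEquiv 2 ℝ ℝ ℝ).toHomeomorph.measurableEmbedding
    (fun x => (starRingEnd ℂ) (f x) * g x)

lemma SchwartzMap.integrable_conj_mul (f g : 𝓢(ℝ × ℝ, ℂ)) :
    Integrable fun x => (starRingEnd ℂ) (f x) * g x :=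
  (f.memLp 2).star.integrable_mul (g.memLp 2)

/-- The dilation `x ↦ f (c • x)` of a Schwartz function. -/
noncomputable def SchwartzMap.dilate (f : 𝓢(ℝ × ℝ, ℂ)) (c : ℝ) (hc : c ≠ 0) : 𝓢(ℝ × ℝ, ℂ) :=
  SchwartzMap.compCLMOfContinuousLinearEquiv ℂ
    (ContinuousLinearEquiv.smulLeft (Units.mk0 c hc)) f

lemma SchwartzMap.dilate_apply (f : 𝓢(ℝ × ℝ, ℂ)) (c : ℝ) (hc : c ≠ 0) (x : ℝ × ℝ) :
    f.dilate c hc x = f (c • x) := rfl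

lemma FwR_dilate_inv (f : 𝓢(ℝ × ℝ, ℂ)) (l : ℝ) (hl : l ≠ 0) (x : ℝ × ℝ) :
    FwR (f.dilate l⁻¹ (inv_ne_zero hl)) x = (l ^ 2 : ℝ) * FwR f (l • x) := by
  have h := Measure.integral_comp_inv_smul (volume : Measure (ℝ × ℝ))
    (fun y => f y * Complex.exp
      ((↑(-(2 * Real.pi * (y.1 * (l • x).2 + y.2 * -(l • x).1))) : ℂ) * Complex.I)) l
  simp only [Module.finrank_prod, Module.finrank_self, Nat.reduceAdd, abs_sq,
    Complex.real_smul] at h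
  rw [FwR, FwR, fourierR2, fourierR2, ← h]
  congr 1 with y
  simp only [SchwartzMap.dilate_apply, Prod.smul_fst, Prod.smul_snd, smul_eq_mul]
  congr 5
  field_simp

/-- Isometry of the twisted Fourier transform: for `f` Schwartz on `ℝ²` and `l ≠ 0`,
`|l| ∫ conj(F_w f(x)) F_w f(l•x) dx = |l|⁻¹ ∫ conj(f(x)) f(l⁻¹•x) dx`,
both integrals converging absolutely. -/
theorem stmt_0 (f : SchwartzMap (ℝ × ℝ) ℂ) (l : ℝ) (hl : l ≠ 0) :
    Integrable (fun x : ℝ × ℝ => (starRingEnd ℂ) (FwR (⇑f) x) * FwR (⇑f) (l • x)) ∧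
    Integrable (fun x : ℝ × ℝ => (starRingEnd ℂ) (f x) * f (l⁻¹ • x)) ∧
    ((|l| : ℝ) : ℂ) * ∫ x : ℝ × ℝ, (starRingEnd ℂ) (FwR (⇑f) x) * FwR (⇑f) (l • x) =
      ((|l|⁻¹ : ℝ) : ℂ) * ∫ x : ℝ × ℝ, (starRingEnd ℂ) (f x) * f (l⁻¹ • x) := by
  refine ⟨?_, f.integrable_conj_mul (f.dilate l⁻¹ (inv_ne_zero hl)), ?_⟩
  · simpa only [SchwartzMap.dilate_apply, coe_schwartzFwR] using
      (schwartzFwR f).integrable_conj_mul ((schwartzFwR f).dilate l hl)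
  · have h := integral_conj_FwR_mul_FwR f (f.dilate l⁻¹ (inv_ne_zero hl))
    simp only [FwR_dilate_inv f l hl, SchwartzMap.dilate_apply, mul_left_comm _ ((l ^ 2 : ℝ) : ℂ)] at h
    rw [← h, integral_const_mul, ← mul_assoc, ← Complex.ofReal_mul]
    congr 2
    rw [← sq_abs, sq, inv_mul_cancel_left₀ (abs_ne_zero.mpr hl)]
end

section
/- For every g in SL(2,ℝ) and every Schwartz function f : ℝ² → ℂ, the twisted Fourier transform F_w commutes with the translation action of SL(2,ℝ): for all x ∈ ℝ², F_w(y ↦ f(g⁻¹·y))(x) = F_w f(g⁻¹·x), where g·y denotes matrix–vector multiplication. -/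
open MeasureTheory

/-- Matrix–vector multiplication of a real 2×2 matrix on `ℝ²`. -/
def SL2Ract (g : Matrix (Fin 2) (Fin 2) ℝ) (x : ℝ × ℝ) : ℝ × ℝ :=
  (g 0 0 * x.1 + g 0 1 * x.2, g 1 0 * x.1 + g 1 1 * x.2)

theorem toLin_finTwoProd_eq_SL2Ract (M : Matrix (Fin 2) (Fin 2) ℝ) :
    ⇑(Matrix.toLin (Module.Basis.finTwoProd ℝ) (Module.Basis.finTwoProd ℝ) M) = SL2Ract M := by
  funext y
  rw [Matrix.eta_fin_two M, Matrix.toLin_finTwoProd_apply]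
  rfl

theorem integral_comp_SL2Ract {E : Type*} [NormedAddCommGroup E] [NormedSpace ℝ E]
    {M : Matrix (Fin 2) (Fin 2) ℝ} (hM : M.det = 1) (F : ℝ × ℝ → E) :
    ∫ y, F (SL2Ract M y) = ∫ y, F y := by
  rw [← toLin_finTwoProd_eq_SL2Ract]
  set L := Matrix.toLin (Module.Basis.finTwoProd ℝ) (Module.Basis.finTwoProd ℝ) M with hL
  have hdet : LinearMap.det L = 1 := by rw [hL, LinearMap.det_toLin, hM]
  have hmap : Measure.map L volume = volume := by
    rw [Measure.map_linearMap_addHaar_eq_smul_addHaar volume (by simp [hdet]), hdet]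
    simp
  have hemb : MeasurableEmbedding L :=
    (LinearMap.equivOfDetNeZero L (by simp [hdet])).toContinuousLinearEquiv
      |>.toHomeomorph.measurableEmbedding
  rw [← hemb.integral_map, hmap]

theorem FwR_comp_SL2Ract {M : Matrix (Fin 2) (Fin 2) ℝ} (hM : M.det = 1) (f : ℝ × ℝ → ℂ)
    (x : ℝ × ℝ) : FwR (fun y => f (SL2Ract M y)) x = FwR f (SL2Ract M x) := by
  unfold FwR fourierR2
  refine Eq.trans ?_ (integral_comp_SL2Ract hM _)
  congr 1 with y
  rw [Matrix.det_fin_two] at hM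
  refine congrArg (fun t : ℝ => f (SL2Ract M y) * Complex.exp ((t : ℂ) * Complex.I)) ?_
  simp only [SL2Ract]
  linear_combination 2 * Real.pi * (y.1 * x.2 - y.2 * x.1) * hM

/-- The twisted Fourier transform `F_w` commutes with the translation action of `SL(2,ℝ)`:
`F_w (f ∘ g⁻¹) = (F_w f) ∘ g⁻¹` for every `g ∈ SL(2,ℝ)` and Schwartz `f`. -/
theorem stmt_3 (g : Matrix.SpecialLinearGroup (Fin 2) ℝ) (f : SchwartzMap (ℝ × ℝ) ℂ)
    (x : ℝ × ℝ) :
    FwR (fun y : ℝ × ℝ => f (SL2Ract (↑g⁻¹) y)) x = FwR (⇑f) (SL2Ract (↑g⁻¹) x) :=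
  FwR_comp_SL2Ract (g⁻¹).det_coe f x
end

section
/- For every g in SL(2,ℂ) and every Schwartz function f : ℂ² → ℂ, the twisted Fourier transform F_w commutes with the translation action of SL(2,ℂ): for all x ∈ ℂ², F_w(y ↦ f(g⁻¹·y))(x) = F_w f(g⁻¹·x), where g·y denotes matrix–vector multiplication. -/
open MeasureTheory

/-- The Fourier transform on `ℂ² = ℂ × ℂ ≅ ℝ⁴`:
`𝓕f(ξ) = ∫ f(x) e^{-2πi Re⟨x,ξ⟩} dx` where `⟨x,ξ⟩ = conj(x₁)ξ₁ + conj(x₂)ξ₂`. -/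
noncomputable def fourierC2 (f : ℂ × ℂ → ℂ) (ξ : ℂ × ℂ) : ℂ :=
  ∫ x : ℂ × ℂ, f x *
    Complex.exp ((↑(-(2 * Real.pi *
      ((starRingEnd ℂ) x.1 * ξ.1 + (starRingEnd ℂ) x.2 * ξ.2).re)) : ℂ) * Complex.I)

/-- The twisted Fourier transform `F_w f(x) = 𝓕f(w⁻¹ x̄) = 𝓕f((conj x₂, -conj x₁))`. -/
noncomputable def FwC (f : ℂ × ℂ → ℂ) (x : ℂ × ℂ) : ℂ :=
  fourierC2 f ((starRingEnd ℂ) x.2, -((starRingEnd ℂ) x.1))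

/-- Matrix–vector multiplication of a complex 2×2 matrix on `ℂ²`. -/
def SL2Cact (g : Matrix (Fin 2) (Fin 2) ℂ) (x : ℂ × ℂ) : ℂ × ℂ :=
  (g 0 0 * x.1 + g 0 1 * x.2, g 1 0 * x.1 + g 1 1 * x.2)

/-- The action of `SL(2,ℂ)` preserves the standard symplectic form on `ℂ²`. -/
theorem SL2Cact_symplectic (g : Matrix.SpecialLinearGroup (Fin 2) ℂ) (x y : ℂ × ℂ) :
    (SL2Cact g x).1 * (SL2Cact g y).2 - (SL2Cact g x).2 * (SL2Cact g y).1 =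
      x.1 * y.2 - x.2 * y.1 := by
  have h := g.det_coe
  rw [Matrix.det_fin_two] at h
  simp only [SL2Cact]
  linear_combination (x.1 * y.2 - x.2 * y.1) * h

theorem SL2Cact_eq_toLin (g : Matrix (Fin 2) (Fin 2) ℂ) :
    SL2Cact g = Matrix.toLin (Module.Basis.finTwoProd ℂ) (Module.Basis.finTwoProd ℂ) g := by
  funext x
  conv_rhs => rw [g.eta_fin_two, Matrix.toLin_finTwoProd_apply]
  rfl

theorem SL2Cact_inv_SL2Cact (g : Matrix.SpecialLinearGroup (Fin 2) ℂ) (x : ℂ × ℂ) :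
    SL2Cact (g⁻¹ : Matrix.SpecialLinearGroup (Fin 2) ℂ) (SL2Cact g x) = x := by
  rw [SL2Cact_eq_toLin, SL2Cact_eq_toLin, ← Matrix.toLin_mul_apply,
    ← Matrix.SpecialLinearGroup.coe_mul, inv_mul_cancel, Matrix.SpecialLinearGroup.coe_one,
    Matrix.toLin_one, LinearMap.id_apply]

theorem continuous_SL2Cact (g : Matrix (Fin 2) (Fin 2) ℂ) : Continuous (SL2Cact g) := by
  unfold SL2Cact
  fun_prop

theorem measurableEmbedding_SL2Cact (g : Matrix.SpecialLinearGroup (Fin 2) ℂ) :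
    MeasurableEmbedding (SL2Cact g) :=
  (continuous_SL2Cact g).measurableEmbedding
    (Function.LeftInverse.injective (SL2Cact_inv_SL2Cact g))

/-- The action of `SL(2,ℂ)` preserves Lebesgue measure on `ℂ²`. -/
theorem measurePreserving_SL2Cact (g : Matrix.SpecialLinearGroup (Fin 2) ℂ) :
    MeasurePreserving (SL2Cact g) := by
  refine ⟨(continuous_SL2Cact g).measurable, ?_⟩
  have hdet : LinearMap.det ((Matrix.toLin (Module.Basis.finTwoProd ℂ)
      (Module.Basis.finTwoProd ℂ) (g : Matrix (Fin 2) (Fin 2) ℂ)).restrictScalars ℝ) = 1 := by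
    rw [LinearMap.det_restrictScalars, LinearMap.det_toLin, g.det_coe, map_one]
  have h := Measure.map_linearMap_addHaar_eq_smul_addHaar ((volume : Measure ℂ).prod (volume : Measure ℂ))
    (hdet.trans_ne one_ne_zero)
  rw [hdet, inv_one, abs_one, ENNReal.ofReal_one, one_smul, LinearMap.coe_restrictScalars,
    ← SL2Cact_eq_toLin] at h
  exact h

/-- The twisted Fourier transform `F_w` commutes with the translation action of `SL(2,ℂ)`:
`F_w (f ∘ g⁻¹) = (F_w f) ∘ g⁻¹` for every `g ∈ SL(2,ℂ)` and Schwartz `f`. -/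
theorem stmt_4 (g : Matrix.SpecialLinearGroup (Fin 2) ℂ) (f : SchwartzMap (ℂ × ℂ) ℂ)
    (x : ℂ × ℂ) :
    FwC (fun y : ℂ × ℂ => f (SL2Cact (↑g⁻¹) y)) x = FwC (⇑f) (SL2Cact (↑g⁻¹) x) := by
  rw [FwC, FwC, fourierC2, fourierC2]
  refine Eq.trans (integral_congr_ae (.of_forall fun y => ?_))
    ((measurePreserving_SL2Cact g⁻¹).integral_comp (measurableEmbedding_SL2Cact g⁻¹) _)
  have h := congrArg (starRingEnd ℂ) (SL2Cact_symplectic g⁻¹ y x)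
  simp only [map_sub, map_mul] at h
  simp only [mul_neg, ← sub_eq_add_neg, h]
end

section
/- Let f : ℝ² → ℂ be a Schwartz function and let x ∈ ℝ², x ≠ 0. Then ∫_ℝ 𝓕f( t•(x₂,−x₁) + ‖x‖⁻²•x ) dt = ∫_ℝ e^{−2πiλ} f(λ•x) dλ, both integrals converging absolutely. (This identity expresses that the composition of the standard intertwining integral I_w with the twisted Fourier transform F_w acts by the module action of the function γ(l) = e^{−2πi l⁻¹} on L ≅ ℝ^×, in the case F = ℝ.) -/
open MeasureTheory

/-- A Schwartz function restricted to an affine line is integrable. -/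
theorem SchwartzMap.integrable_comp_line {E F : Type*} [NormedAddCommGroup E] [NormedSpace ℝ E]
    [NormedAddCommGroup F] [NormedSpace ℝ F] (f : SchwartzMap E F) (u : E) {v : E} (hv : v ≠ 0) :
    Integrable fun t : ℝ => f (t • v + u) := by
  have hg : (fun t : ℝ => t • v + u).HasTemperateGrowth := by fun_prop
  have ha : AntilipschitzWith ‖v‖₊⁻¹ (fun t : ℝ => t • v + u) := by
    refine AntilipschitzWith.of_le_mul_dist fun s t => ?_
    have hv' : ‖v‖ ≠ 0 := norm_ne_zero_iff.2 hv
    rw [dist_add_right, dist_eq_norm (s • v), ← sub_smul, norm_smul, dist_eq_norm,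
      NNReal.coe_inv, coe_nnnorm]
    exact le_of_eq (by field_simp)
  exact (SchwartzMap.compCLMOfAntilipschitz ℝ hg ha f).integrable

/-- `fourierR2` of a Schwartz function is a Schwartz function on the Euclidean plane. -/
theorem exists_schwartzMap_fourierR2 (f : SchwartzMap (ℝ × ℝ) ℂ) :
    ∃ F : SchwartzMap (WithLp 2 (ℝ × ℝ)) ℂ, ∀ ξ, fourierR2 f ξ = F (WithLp.toLp 2 ξ) := by
  refine ⟨FourierTransform.fourier (SchwartzMap.compCLMOfContinuousLinearEquiv ℝ
    (WithLp.prodContinuousLinearEquiv 2 ℝ ℝ ℝ) f), fun ξ => ?_⟩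
  have hp : MeasurePreserving (WithLp.toLp 2 : ℝ × ℝ → WithLp 2 (ℝ × ℝ)) :=
    WithLp.volume_preserving_toLp _ _
  rw [SchwartzMap.fourier_coe, Real.fourier_eq', fourierR2,
    ← hp.integral_comp (MeasurableEquiv.toLp 2 (ℝ × ℝ)).measurableEmbedding]
  refine integral_congr_ae (.of_forall fun y => ?_)
  simp [mul_comm]

/-- The partial Fourier integral of a Schwartz function is continuous. -/
theorem SchwartzMap.continuous_integral_exp_mul (g : SchwartzMap (ℝ × ℝ) ℂ) :
    Continuous fun s : ℝ =>
      ∫ l : ℝ, Complex.exp ((↑(-(2 * Real.pi * l)) : ℂ) * Complex.I) * g (l, s) := by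
  obtain ⟨C₀, -, h₀⟩ := g.decay 0 0
  obtain ⟨C₂, -, h₂⟩ := g.decay 2 0
  simp only [pow_zero, one_mul, norm_iteratedFDeriv_zero] at h₀ h₂
  refine continuous_of_dominated (bound := fun l => (C₀ + C₂) * (1 + l ^ 2)⁻¹)
    (fun s => Continuous.aestronglyMeasurable ?_) (fun s => .of_forall fun l => ?_)
    (integrable_inv_one_add_sq.const_mul _) (.of_forall fun l => ?_)
  · have := g.continuous
    fun_prop
  · rw [norm_mul, Complex.norm_exp_ofReal_mul_I, one_mul, ← div_eq_mul_inv,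
      le_div_iff₀ (by positivity)]
    have hl : l ^ 2 ≤ ‖(l, s)‖ ^ 2 := by
      rw [← sq_abs]
      exact pow_le_pow_left₀ (abs_nonneg l) (le_max_left _ _) 2
    nlinarith [h₀ (l, s), h₂ (l, s), norm_nonneg (g (l, s))]
  · have := g.continuous
    fun_prop

/-- The linear map `(l, s) ↦ l • x + s • ‖x‖⁻² • (x₂, -x₁)` is a measure-preserving
automorphism of the plane. -/
theorem exists_measurePreserving_equiv {x : ℝ × ℝ} (hN : x.1 ^ 2 + x.2 ^ 2 ≠ 0) :
    ∃ A : (ℝ × ℝ) ≃L[ℝ] (ℝ × ℝ), MeasurePreserving A ∧ ∀ p,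
      A p = p.1 • x + (p.2 * (x.1 ^ 2 + x.2 ^ 2)⁻¹) • ((x.2, -x.1) : ℝ × ℝ) := by
  set N := x.1 ^ 2 + x.2 ^ 2 with hNdef
  let b := Module.Basis.finTwoProd ℝ
  let L : (ℝ × ℝ) →ₗ[ℝ] (ℝ × ℝ) := Matrix.toLin b b !![x.1, N⁻¹ * x.2; x.2, -(N⁻¹ * x.1)]
  have hdet : LinearMap.det L = -1 := by
    rw [LinearMap.det_toLin, Matrix.det_fin_two_of]
    field_simp
    rw [hNdef]
    ring
  have hdet0 : LinearMap.det L ≠ 0 := by rw [hdet]; norm_num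
  refine ⟨(LinearEquiv.ofIsUnitDet (f := L) (v := b) (v' := b) ?_).toContinuousLinearEquiv,
    ⟨?_, ?_⟩, fun p => ?_⟩
  · rw [LinearMap.det_toMatrix, hdet]
    exact isUnit_one.neg
  · exact (ContinuousLinearEquiv.continuous _).measurable
  · have h := Measure.map_linearMap_addHaar_eq_smul_addHaar (volume : Measure (ℝ × ℝ)) hdet0
    rw [hdet] at h
    norm_num at h
    exact h
  · change L p = _
    rw [Matrix.toLin_finTwoProd_apply]
    ext <;> simp <;> ring

/-- For `f` Schwartz on `ℝ²` and `x ≠ 0`,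
`∫_ℝ 𝓕f(t•(x₂,-x₁) + ‖x‖⁻²•x) dt = ∫_ℝ e^{-2πiλ} f(λ•x) dλ`,
both integrals converging absolutely.  Here `‖x‖² = x₁² + x₂²` is the Euclidean norm.
This expresses that `I_w ∘ F_w` acts by the module action of `γ(l) = e^{-2πi l⁻¹}`. -/
theorem stmt_5 (f : SchwartzMap (ℝ × ℝ) ℂ) (x : ℝ × ℝ) (hx : x ≠ 0) :
    Integrable (fun t : ℝ =>
      fourierR2 (⇑f) (t • ((x.2, -x.1) : ℝ × ℝ) + ((x.1 ^ 2 + x.2 ^ 2)⁻¹ : ℝ) • x)) ∧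
    Integrable (fun lam : ℝ =>
      Complex.exp ((↑(-(2 * Real.pi * lam)) : ℂ) * Complex.I) * f (lam • x)) ∧
    ∫ t : ℝ, fourierR2 (⇑f) (t • ((x.2, -x.1) : ℝ × ℝ) + ((x.1 ^ 2 + x.2 ^ 2)⁻¹ : ℝ) • x) =
      ∫ lam : ℝ, Complex.exp ((↑(-(2 * Real.pi * lam)) : ℂ) * Complex.I) * f (lam • x) := by
  set N := x.1 ^ 2 + x.2 ^ 2 with hNdef
  have hN : N ≠ 0 := by
    intro h
    exact hx (Prod.ext (by simpa using (by nlinarith [sq_nonneg x.1, sq_nonneg x.2] :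
      x.1 ^ 2 = 0)) (by simpa using (by nlinarith [sq_nonneg x.1, sq_nonneg x.2] : x.2 ^ 2 = 0)))
  have hleft : Integrable fun t : ℝ =>
      fourierR2 f (t • ((x.2, -x.1) : ℝ × ℝ) + (N⁻¹ : ℝ) • x) := by
    obtain ⟨F, hF⟩ := exists_schwartzMap_fourierR2 f
    simp only [hF]
    refine F.integrable_comp_line (WithLp.toLp 2 (N⁻¹ • x))
      (v := WithLp.toLp 2 ((x.2, -x.1) : ℝ × ℝ)) fun h => hx ?_
    have h' := congrArg WithLp.ofLp h
    simp only [WithLp.ofLp_zero, Prod.mk_eq_zero, neg_eq_zero] at h'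
    exact Prod.ext h'.2 h'.1
  have hright : Integrable fun l : ℝ =>
      Complex.exp ((↑(-(2 * Real.pi * l)) : ℂ) * Complex.I) * f (l • x) := by
    have hf : Integrable fun l : ℝ => f (l • x) := by
      simpa using f.integrable_comp_line 0 hx
    refine hf.bdd_mul (c := 1) (Continuous.aestronglyMeasurable (by fun_prop))
      (.of_forall fun l => ?_)
    rw [Complex.norm_exp_ofReal_mul_I]
  refine ⟨hleft, hright, ?_⟩
  obtain ⟨A, hA, hAp⟩ := exists_measurePreserving_equiv hN
  let g := SchwartzMap.compCLMOfContinuousLinearEquiv ℝ A f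
  let h : ℝ → ℂ := fun s =>
    ∫ l : ℝ, Complex.exp ((↑(-(2 * Real.pi * l)) : ℂ) * Complex.I) * g (l, s)
  have hcont : Continuous h := g.continuous_integral_exp_mul
  have hg : Integrable fun p : ℝ × ℝ =>
      Complex.exp ((↑(-(2 * Real.pi * p.1)) : ℂ) * Complex.I) * g p := by
    refine g.integrable.bdd_mul (c := 1) (Continuous.aestronglyMeasurable (by fun_prop))
      (.of_forall fun p => ?_)
    rw [Complex.norm_exp_ofReal_mul_I]
  have hint : Integrable h := hg.integral_prod_right
  have hfour : ∀ t : ℝ, fourierR2 f (t • ((x.2, -x.1) : ℝ × ℝ) + (N⁻¹ : ℝ) • x) =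
      FourierTransform.fourier h t := by
    intro t
    have hgt : Integrable fun p : ℝ × ℝ =>
        Complex.exp ((↑(-(2 * Real.pi * p.2 * t)) : ℂ) * Complex.I) *
          (Complex.exp ((↑(-(2 * Real.pi * p.1)) : ℂ) * Complex.I) * g p) := by
      refine hg.bdd_mul (c := 1) (Continuous.aestronglyMeasurable (by fun_prop))
        (.of_forall fun p => ?_)
      rw [Complex.norm_exp_ofReal_mul_I]
    have hchange : fourierR2 f (t • ((x.2, -x.1) : ℝ × ℝ) + (N⁻¹ : ℝ) • x) =
        ∫ p : ℝ × ℝ, Complex.exp ((↑(-(2 * Real.pi * p.2 * t)) : ℂ) * Complex.I) *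
          (Complex.exp ((↑(-(2 * Real.pi * p.1)) : ℂ) * Complex.I) * g p) := by
      rw [fourierR2, ← hA.integral_comp A.toHomeomorph.measurableEmbedding]
      refine integral_congr_ae (.of_forall fun p => ?_)
      have hphase : (A p).1 * (t • ((x.2, -x.1) : ℝ × ℝ) + (N⁻¹ : ℝ) • x).1 +
          (A p).2 * (t • ((x.2, -x.1) : ℝ × ℝ) + (N⁻¹ : ℝ) • x).2 = p.1 + p.2 * t := by
        rw [hAp]
        simp only [Prod.fst_add, Prod.snd_add, Prod.smul_fst, Prod.smul_snd, smul_eq_mul]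
        rw [← hNdef]
        field_simp
        rw [hNdef]
        ring
      simp only [hphase]
      rw [← mul_assoc, ← Complex.exp_add, mul_comm]
      change _ = _ * f (A p)
      congr 2
      push_cast
      ring
    rw [hchange, Real.fourier_real_eq_integral_exp_smul, Measure.volume_eq_prod,
      integral_prod_symm _ hgt]
    refine integral_congr_ae (.of_forall fun s => ?_)
    simp only [smul_eq_mul, integral_const_mul, h, neg_mul]
  simp only [hfour] at hleft ⊢
  have hinv := hint.fourierInv_fourier_eq hleft (v := 0) hcont.continuousAt
  rw [Real.fourierInv_eq'] at hinv
  simp only [inner_zero_right, mul_zero, Complex.ofReal_zero, zero_mul, Complex.exp_zero,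
    one_smul] at hinv
  rw [hinv]
  refine integral_congr_ae (.of_forall fun l => ?_)
  change _ * f (A (l, 0)) = _
  rw [hAp]
  simp
end

section
/- Let f : ℂ² → ℂ be a Schwartz function (identifying ℂ² with ℝ⁴) and let x ∈ ℂ², x ≠ 0. Then ∫_ℂ 𝓕f( s·(conj(x₂), −conj(x₁)) + ‖x‖⁻²·x ) ds = ∫_ℂ e^{−2πi Re(λ)} f(λ·x) dλ, both integrals converging absolutely; here s·(y₁,y₂) = (sy₁, sy₂) and ‖x‖² = |x₁|² + |x₂|². (This identity expresses that the composition of the standard intertwining integral I_w with the twisted Fourier transform F_w acts by the module action of the function γ(l) = e^{−2πi Re(l⁻¹)} on L ≅ ℂ^×, in the case F = ℂ.) -/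
open MeasureTheory

open scoped FourierTransform

theorem SchwartzMap.exists_norm_le_one_add_norm_rpow_neg {E F : Type*} [NormedAddCommGroup E]
    [NormedSpace ℝ E] [NormedAddCommGroup F] [NormedSpace ℝ F] (g : SchwartzMap E F) (k : ℕ) :
    ∃ C : ℝ, 0 ≤ C ∧ ∀ x, ‖g x‖ ≤ C * (1 + ‖x‖) ^ (-(k : ℝ)) := by
  refine ⟨2 ^ k * ((Finset.Iic (k, 0)).sup fun m => SchwartzMap.seminorm ℝ m.1 m.2) g,
    by positivity, fun x => ?_⟩
  have h := g.one_add_le_sup_seminorm_apply (𝕜 := ℝ) (m := (k, 0)) le_rfl le_rfl x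
  have hx : 0 < 1 + ‖x‖ := by positivity
  rw [norm_iteratedFDeriv_zero] at h
  rwa [Real.rpow_neg hx.le, Real.rpow_natCast, ← div_eq_mul_inv, le_div_iff₀' (by positivity)]

/-- A Schwartz function is bounded, on vectors of norm at least `‖s‖`, by `B s` for a function `B`
integrable on any prescribed finite-dimensional space. -/
theorem SchwartzMap.exists_integrable_bound (D : Type*) {E F : Type*} [NormedAddCommGroup D]
    [NormedSpace ℝ D] [FiniteDimensional ℝ D] [MeasurableSpace D] [BorelSpace D]
    (μ : Measure D) [μ.IsAddHaarMeasure] [NormedAddCommGroup E] [NormedSpace ℝ E]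
    [NormedAddCommGroup F] [NormedSpace ℝ F] (g : SchwartzMap E F) :
    ∃ B : D → ℝ, Integrable B μ ∧ ∀ (s : D) (x : E), ‖s‖ ≤ ‖x‖ → ‖g x‖ ≤ B s := by
  obtain ⟨C, hC, h⟩ := g.exists_norm_le_one_add_norm_rpow_neg (Module.finrank ℝ D + 1)
  refine ⟨_, (integrable_one_add_norm (μ := μ) (E := D)
    (r := (Module.finrank ℝ D + 1 : ℕ)) (by push_cast; linarith)).const_mul C,
    fun s x hsx => (h x).trans ?_⟩
  gcongr C * ?_
  exact Real.rpow_le_rpow_of_nonpos (by positivity) (by gcongr)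
    (neg_nonpos.2 (Nat.cast_nonneg _))

theorem SchwartzMap.integrable_comp_of_norm_le {D E F : Type*} [NormedAddCommGroup D]
    [NormedSpace ℝ D] [FiniteDimensional ℝ D] [MeasurableSpace D] [BorelSpace D]
    (μ : Measure D) [μ.IsAddHaarMeasure] [NormedAddCommGroup E] [NormedSpace ℝ E]
    [NormedAddCommGroup F] [NormedSpace ℝ F] (g : SchwartzMap E F) {φ : D → E}
    (hφ : Continuous φ) (h : ∀ s, ‖s‖ ≤ ‖φ s‖) : Integrable (fun s => g (φ s)) μ := by
  obtain ⟨B, hB, hg⟩ := g.exists_integrable_bound D μ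
  exact hB.mono' (g.continuous.comp hφ).aestronglyMeasurable
    (Filter.Eventually.of_forall fun s => hg s _ (h s))

theorem norm_exp_neg_two_pi_mul_I (r : ℝ) :
    ‖Complex.exp ((↑(-(2 * Real.pi * r)) : ℂ) * Complex.I)‖ = 1 :=
  Complex.norm_exp_ofReal_mul_I _

theorem fourierC2_eq_fourier (f : SchwartzMap (ℂ × ℂ) ℂ) (ξ : ℂ × ℂ) :
    fourierC2 f ξ = 𝓕 (SchwartzMap.compCLMOfContinuousLinearEquiv ℂ
      (WithLp.prodContinuousLinearEquiv 2 ℝ ℂ ℂ) f) (WithLp.toLp 2 ξ) := by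
  rw [SchwartzMap.fourier_coe, Real.fourier_eq', fourierC2,
    ← (WithLp.volume_preserving_ofLp ℂ ℂ).integral_comp
      (WithLp.homeomorphProd 2 ℂ ℂ).measurableEmbedding]
  refine integral_congr_ae (Filter.Eventually.of_forall fun v => ?_)
  simp only [smul_eq_mul, SchwartzMap.compCLMOfContinuousLinearEquiv_apply, Function.comp_apply,
    WithLp.prodContinuousLinearEquiv_apply, WithLp.prod_inner_apply, Complex.inner]
  rw [mul_comm]
  congr 4
  simp only [Complex.add_re]
  ring_nf

theorem integrable_fourierC2_line (f : SchwartzMap (ℂ × ℂ) ℂ) (c : ℂ) :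
    Integrable (fun s : ℂ => fourierC2 f (c, s)) := by
  simp_rw [fourierC2_eq_fourier]
  refine SchwartzMap.integrable_comp_of_norm_le volume _ (by fun_prop) fun s => ?_
  refine le_of_sq_le_sq ?_ (norm_nonneg _)
  rw [WithLp.prod_norm_sq_eq_of_L2]
  simp

theorem integrable_exp_mul_schwartz_line (f : SchwartzMap (ℂ × ℂ) ℂ) (c : ℂ) :
    Integrable (fun lam : ℂ =>
      Complex.exp ((↑(-(2 * Real.pi * lam.re)) : ℂ) * Complex.I) * f (lam, c)) := by
  refine Integrable.bdd_mul (c := 1) (SchwartzMap.integrable_comp_of_norm_le volume f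
    (by fun_prop) fun s => le_max_left _ _) (by fun_prop) ?_
  exact Filter.Eventually.of_forall fun _ => (norm_exp_neg_two_pi_mul_I _).le

theorem integral_fourierC2_line (f : SchwartzMap (ℂ × ℂ) ℂ) :
    ∫ s : ℂ, fourierC2 f (1, s) =
      ∫ lam : ℂ, Complex.exp ((↑(-(2 * Real.pi * lam.re)) : ℂ) * Complex.I) * f (lam, 0) := by
  set G : ℂ → ℂ := fun m =>
    ∫ lam : ℂ, Complex.exp ((↑(-(2 * Real.pi * lam.re)) : ℂ) * Complex.I) * f (lam, m) with hG
  have hprod : Integrable (fun p : ℂ × ℂ =>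
      Complex.exp ((↑(-(2 * Real.pi * p.1.re)) : ℂ) * Complex.I) * f p)
      (volume.prod volume) := by
    refine Integrable.bdd_mul (c := 1) f.integrable (by fun_prop) ?_
    exact Filter.Eventually.of_forall fun _ => (norm_exp_neg_two_pi_mul_I _).le
  have hGi : Integrable G := hprod.integral_prod_right
  have hGc : Continuous G := by
    obtain ⟨B, hB, hf⟩ := f.exists_integrable_bound ℂ volume
    refine continuous_of_dominated (bound := B)
      (fun m => (integrable_exp_mul_schwartz_line f m).aestronglyMeasurable) (fun m => ?_) hB ?_
    · refine Filter.Eventually.of_forall fun lam => ?_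
      rw [norm_mul, norm_exp_neg_two_pi_mul_I, one_mul]
      exact hf _ _ (le_max_left _ _)
    · exact Filter.Eventually.of_forall fun lam => by fun_prop
  have hF : 𝓕 G = fun s => fourierC2 f (1, s) := by
    funext s
    rw [Real.fourier_eq', fourierC2, Measure.volume_eq_prod, integral_prod_symm]
    · refine integral_congr_ae (Filter.Eventually.of_forall fun m => ?_)
      simp only [hG, smul_eq_mul]
      rw [← integral_const_mul]
      refine integral_congr_ae (Filter.Eventually.of_forall fun lam => ?_)
      simp only
      rw [← mul_assoc, ← Complex.exp_add, mul_comm, ← add_mul, ← Complex.ofReal_add]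
      congr 4
      simp [Complex.inner]
      ring
    · refine Integrable.mul_bdd (c := 1) f.integrable (by fun_prop) ?_
      exact Filter.Eventually.of_forall fun _ => (norm_exp_neg_two_pi_mul_I _).le
  have hinv := hGi.fourierInv_fourier_eq (hF ▸ integrable_fourierC2_line f 1)
    (hGc.continuousAt (x := 0))
  rw [Real.fourierInv_eq', hF] at hinv
  simpa [-Complex.ofReal_neg, -Complex.ofReal_mul, hG] using hinv

/-- The squared Euclidean norm on `ℂ²`. -/
noncomputable def normSqC2 (x : ℂ × ℂ) : ℝ := Complex.normSq x.1 + Complex.normSq x.2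

theorem normSqC2_pos {x : ℂ × ℂ} (hx : x ≠ 0) : 0 < normSqC2 x := by
  unfold normSqC2
  by_cases h : x.1 = 0
  · have h2 : x.2 ≠ 0 := fun h2 => hx (Prod.ext h h2)
    exact add_pos_of_nonneg_of_pos (Complex.normSq_nonneg _) (Complex.normSq_pos.2 h2)
  · exact add_pos_of_pos_of_nonneg (Complex.normSq_pos.2 h) (Complex.normSq_nonneg _)

theorem ofReal_normSqC2 (x : ℂ × ℂ) : (normSqC2 x : ℂ) =
    (starRingEnd ℂ) x.1 * x.1 + (starRingEnd ℂ) x.2 * x.2 := by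
  simp [normSqC2, Complex.normSq_eq_conj_mul_self]

/-- The change of coordinates `(l, m) ↦ l • x + m • (conj x₂, -conj x₁)`. -/
noncomputable def orthoFrame (x : ℂ × ℂ) : (ℂ × ℂ) →ₗ[ℂ] (ℂ × ℂ) :=
  (LinearMap.toSpanSingleton ℂ _ x).coprod
    (LinearMap.toSpanSingleton ℂ _ ((starRingEnd ℂ) x.2, -(starRingEnd ℂ) x.1))

theorem orthoFrame_apply (x p : ℂ × ℂ) : orthoFrame x p =
    (p.1 * x.1 + p.2 * (starRingEnd ℂ) x.2, p.1 * x.2 - p.2 * (starRingEnd ℂ) x.1) := by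
  simp [orthoFrame, Prod.ext_iff, sub_eq_add_neg]

theorem det_orthoFrame (x : ℂ × ℂ) : LinearMap.det (orthoFrame x) = -(normSqC2 x : ℂ) := by
  rw [← LinearMap.det_toMatrix (Module.Basis.finTwoProd ℂ), Matrix.det_fin_two]
  simp [LinearMap.toMatrix_apply, orthoFrame_apply, ofReal_normSqC2]
  ring

theorem det_restrictScalars_orthoFrame (x : ℂ × ℂ) :
    LinearMap.det ((orthoFrame x).restrictScalars ℝ) = normSqC2 x ^ 2 := by
  rw [LinearMap.det_restrictScalars, det_orthoFrame, Algebra.norm_complex_apply]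
  simp [Complex.normSq_ofReal, sq]

/-- `orthoFrame x` as a real continuous linear automorphism, for `x ≠ 0`. -/
noncomputable def orthoFrameEquiv {x : ℂ × ℂ} (hx : x ≠ 0) : (ℂ × ℂ) ≃L[ℝ] (ℂ × ℂ) :=
  (LinearEquiv.ofIsUnitDet (f := (orthoFrame x).restrictScalars ℝ)
    (v := Module.finBasis ℝ _) (v' := Module.finBasis ℝ _) (by
      rw [LinearMap.det_toMatrix, det_restrictScalars_orthoFrame]
      exact (pow_ne_zero 2 (normSqC2_pos hx).ne').isUnit)).toContinuousLinearEquiv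

theorem orthoFrameEquiv_apply {x : ℂ × ℂ} (hx : x ≠ 0) (p : ℂ × ℂ) :
    orthoFrameEquiv hx p = orthoFrame x p := rfl

theorem integral_eq_integral_comp_orthoFrameEquiv {x : ℂ × ℂ} (hx : x ≠ 0) (g : ℂ × ℂ → ℂ) :
    ∫ y, g y = (normSqC2 x ^ 2) • ∫ p, g (orthoFrameEquiv hx p) := by
  have hN := normSqC2_pos hx
  have : (volume : Measure (ℂ × ℂ)).IsAddHaarMeasure :=
    inferInstanceAs (((volume : Measure ℂ).prod (volume : Measure ℂ)).IsAddHaarMeasure)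
  have h := Measure.map_linearMap_addHaar_eq_smul_addHaar (volume : Measure (ℂ × ℂ))
    (f := (orthoFrame x).restrictScalars ℝ)
    (by rw [det_restrictScalars_orthoFrame]; positivity)
  rw [det_restrictScalars_orthoFrame] at h
  have h2 := (orthoFrameEquiv hx).toHomeomorph.measurableEmbedding.integral_map
    (μ := volume) g
  change ∫ y, g y ∂(Measure.map ((orthoFrame x).restrictScalars ℝ) volume) =
    ∫ p, g (orthoFrameEquiv hx p) at h2
  rw [← h2, h, integral_smul_measure, ENNReal.toReal_ofReal (abs_nonneg _),
    abs_of_pos (by positivity), smul_smul, mul_inv_cancel₀ (by positivity), one_smul]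

theorem fourierC2_orthogonal_line (f : SchwartzMap (ℂ × ℂ) ℂ) {x : ℂ × ℂ} (hx : x ≠ 0) (s : ℂ) :
    fourierC2 f ((s * (starRingEnd ℂ) x.2, -(s * (starRingEnd ℂ) x.1)) + (normSqC2 x)⁻¹ • x) =
      (normSqC2 x ^ 2) • fourierC2
        (SchwartzMap.compCLMOfContinuousLinearEquiv ℂ (orthoFrameEquiv hx) f)
        (1, normSqC2 x • s) := by
  have hN : (normSqC2 x : ℂ) ≠ 0 := by exact_mod_cast (normSqC2_pos hx).ne'
  rw [fourierC2, integral_eq_integral_comp_orthoFrameEquiv hx, fourierC2]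
  congr 2
  funext p
  rw [SchwartzMap.compCLMOfContinuousLinearEquiv_apply, Function.comp_apply,
    orthoFrameEquiv_apply]
  congr 7
  simp only [orthoFrame_apply, Prod.fst_add, Prod.snd_add, Prod.smul_fst, Prod.smul_snd,
    Complex.real_smul, map_add, map_sub, map_mul, Complex.conj_conj, Complex.ofReal_inv, mul_one]
  field_simp
  rw [ofReal_normSqC2]
  ring

/-- For `f` Schwartz on `ℂ²` and `x ≠ 0`,
`∫_ℂ 𝓕f(s·(conj x₂, -conj x₁) + ‖x‖⁻²·x) ds = ∫_ℂ e^{-2πi Re(λ)} f(λ·x) dλ`,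
both integrals converging absolutely.  Here `s·(y₁,y₂) = (s y₁, s y₂)` and
`‖x‖² = |x₁|² + |x₂|²`.  This expresses that `I_w ∘ F_w` acts by the module action of
`γ(l) = e^{-2πi Re(l⁻¹)}` on `L ≅ ℂ^×`. -/
theorem stmt_6 (f : SchwartzMap (ℂ × ℂ) ℂ) (x : ℂ × ℂ) (hx : x ≠ 0) :
    Integrable (fun s : ℂ =>
      fourierC2 (⇑f) ((s * (starRingEnd ℂ) x.2, -(s * (starRingEnd ℂ) x.1)) +
        ((Complex.normSq x.1 + Complex.normSq x.2)⁻¹ : ℝ) • x)) ∧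
    Integrable (fun lam : ℂ =>
      Complex.exp ((↑(-(2 * Real.pi * lam.re)) : ℂ) * Complex.I) * f (lam * x.1, lam * x.2)) ∧
    ∫ s : ℂ, fourierC2 (⇑f) ((s * (starRingEnd ℂ) x.2, -(s * (starRingEnd ℂ) x.1)) +
        ((Complex.normSq x.1 + Complex.normSq x.2)⁻¹ : ℝ) • x) =
      ∫ lam : ℂ, Complex.exp ((↑(-(2 * Real.pi * lam.re)) : ℂ) * Complex.I) *
        f (lam * x.1, lam * x.2) := by
  have hN := normSqC2_pos hx
  set g := SchwartzMap.compCLMOfContinuousLinearEquiv ℂ (orthoFrameEquiv hx) f with hg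
  have hgf (lam : ℂ) : g (lam, 0) = f (lam * x.1, lam * x.2) := by
    simp [hg, orthoFrameEquiv_apply, orthoFrame_apply]
  have hline := fourierC2_orthogonal_line f hx
  rw [← hg] at hline
  simp only [normSqC2] at hline hN
  simp_rw [hline, ← hgf]
  refine ⟨?_, integrable_exp_mul_schwartz_line g 0, ?_⟩
  · exact ((integrable_comp_smul_iff volume (fun s : ℂ => fourierC2 g (1, s)) hN.ne').2
      (integrable_fourierC2_line g 1)).smul
      ((Complex.normSq x.1 + Complex.normSq x.2) ^ 2)
  · rw [integral_smul, Measure.integral_comp_smul volume (fun s : ℂ => fourierC2 g (1, s)),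
      Complex.finrank_real_complex, abs_of_pos (by positivity), smul_smul,
      mul_inv_cancel₀ (by positivity), one_smul, integral_fourierC2_line]
end

section
/- Let h : ℝ² → ℂ be a Schwartz function and let l be a nonzero real number. Then |l| · | ∫_{ℝ²} conj(h(x)) · h(l•x) dx | ≤ (sup_{x∈ℝ²} |h(x)|) · (∫_{ℝ²} |h(x)| dx) · min(|l|, |l|⁻¹). -/
open MeasureTheory

/-- The values of a Schwartz function are bounded in norm by their supremum. -/
theorem SchwartzMap.norm_apply_le_iSup {E F : Type*} [NormedAddCommGroup E] [NormedSpace ℝ E]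
    [NormedAddCommGroup F] [NormedSpace ℝ F] (h : SchwartzMap E F) (x : E) :
    ‖h x‖ ≤ ⨆ y, ‖h y‖ := by
  obtain ⟨C, hC⟩ := h.decay 0 0
  refine le_ciSup (f := fun y => ‖h y‖) ⟨C, ?_⟩ x
  rintro _ ⟨y, rfl⟩
  simpa using hC.2 y

/-- For `h` Schwartz on `ℝ²` and `l ≠ 0`,
`|l| · |∫ conj(h(x)) h(l•x) dx| ≤ ‖h‖_∞ ‖h‖₁ min(|l|, |l|⁻¹)`. -/
theorem stmt_9 (h : SchwartzMap (ℝ × ℝ) ℂ) (l : ℝ) (hl : l ≠ 0) :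
    |l| * ‖∫ x : ℝ × ℝ, (starRingEnd ℂ) (h x) * h (l • x)‖ ≤
      (⨆ x : ℝ × ℝ, ‖h x‖) * (∫ x : ℝ × ℝ, ‖h x‖) * min |l| |l|⁻¹ := by
  set M := ⨆ x : ℝ × ℝ, ‖h x‖
  have hM : ∀ x, ‖h x‖ ≤ M := h.norm_apply_le_iSup
  have hint : Integrable (fun x : ℝ × ℝ => ‖h x‖) := h.integrable.norm
  have bound_left : ‖∫ x : ℝ × ℝ, (starRingEnd ℂ) (h x) * h (l • x)‖ ≤ M * ∫ x, ‖h x‖ := by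
    rw [← integral_const_mul]
    refine norm_integral_le_of_norm_le (hint.const_mul M) (.of_forall fun x => ?_)
    rw [norm_mul, RCLike.norm_conj, mul_comm]
    exact mul_le_mul_of_nonneg_right (hM _) (norm_nonneg _)
  have bound_right : ‖∫ x : ℝ × ℝ, (starRingEnd ℂ) (h x) * h (l • x)‖ ≤
      M * ((|l| ^ 2)⁻¹ * ∫ x, ‖h x‖) := by
    have hscale : ∫ x : ℝ × ℝ, ‖h (l • x)‖ = (|l| ^ 2)⁻¹ * ∫ x, ‖h x‖ := by
      simpa [Module.finrank_prod] using
        Measure.integral_comp_smul (volume : Measure (ℝ × ℝ)) (fun x => ‖h x‖) l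
    rw [← hscale, ← integral_const_mul]
    refine norm_integral_le_of_norm_le ((hint.comp_smul hl).const_mul M)
      (.of_forall fun x => ?_)
    rw [norm_mul, RCLike.norm_conj]
    exact mul_le_mul_of_nonneg_right (hM _) (norm_nonneg _)
  have hl0 : |l| ≠ 0 := abs_ne_zero.mpr hl
  rcases min_choice |l| |l|⁻¹ with hmin | hmin <;> rw [hmin]
  · rw [mul_comm |l|]
    gcongr
  · calc _ ≤ |l| * (M * ((|l| ^ 2)⁻¹ * ∫ x, ‖h x‖)) := by gcongr
      _ = _ := by field_simp
end

section
/- Let f : ℝ² → ℂ be a Schwartz function. Then the function φ : ℝ∖{0} → ℂ defined by φ(l) = |l| · ∫_{ℝ²} conj(f(x)) · f(l•x) dx is integrable on ℝ∖{0} with respect to the multiplicative Haar measure dl/|l|, i.e. ∫_{ℝ∖{0}} |φ(l)| · |l|⁻¹ dl < ∞. -/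
open MeasureTheory

/-- The correlation of a bounded integrable `f` on `ℝ²` with its dilate by `l` decays
like `(1 + l²)⁻¹`. -/
lemma norm_integral_conj_mul_comp_smul_le {f : ℝ × ℝ → ℂ} (hf : Integrable f) {M : ℝ}
    (hM : ∀ x, ‖f x‖ ≤ M) {l : ℝ} (hl : l ≠ 0) :
    ‖∫ x : ℝ × ℝ, (starRingEnd ℂ) (f x) * f (l • x)‖ ≤
      2 * (M * ∫ x, ‖f x‖) * (1 + l ^ 2)⁻¹ := by
  have near : ‖∫ x : ℝ × ℝ, (starRingEnd ℂ) (f x) * f (l • x)‖ ≤ M * ∫ x, ‖f x‖ := by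
    rw [← integral_const_mul]
    refine norm_integral_le_of_norm_le (hf.norm.const_mul M) (.of_forall fun x => ?_)
    rw [norm_mul, RCLike.norm_conj, mul_comm]
    exact mul_le_mul_of_nonneg_right (hM _) (norm_nonneg _)
  have far : ‖∫ x : ℝ × ℝ, (starRingEnd ℂ) (f x) * f (l • x)‖ ≤
      M * ((l ^ 2)⁻¹ * ∫ x, ‖f x‖) := by
    have dilate : ∫ x : ℝ × ℝ, ‖f (l • x)‖ = (l ^ 2)⁻¹ * ∫ x, ‖f x‖ := by
      rw [Measure.integral_comp_smul volume (fun x => ‖f x‖) l]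
      simp [Module.finrank_prod]
    rw [← dilate, ← integral_const_mul]
    refine norm_integral_le_of_norm_le ((hf.comp_smul hl).norm.const_mul M)
      (.of_forall fun x => ?_)
    rw [norm_mul, RCLike.norm_conj]
    exact mul_le_mul_of_nonneg_right (hM _) (norm_nonneg _)
  have hl2 : 0 < l ^ 2 := by positivity
  rw [← div_eq_mul_inv, le_div_iff₀ (by positivity)]
  have scaled := mul_le_mul_of_nonneg_right far hl2.le
  have cancel : M * ((l ^ 2)⁻¹ * ∫ x, ‖f x‖) * l ^ 2 = M * ∫ x, ‖f x‖ := by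
    field_simp
  linarith

/-- For `f` Schwartz on `ℝ²`, the function `φ(l) = |l| ∫ conj(f(x)) f(l•x) dx` satisfies
`∫_{ℝ∖{0}} |φ(l)| |l|⁻¹ dl < ∞`, i.e. `φ` is integrable with respect to the multiplicative
Haar measure `dl/|l|` on `ℝ^×`. -/
theorem stmt_10 (f : SchwartzMap (ℝ × ℝ) ℂ) :
    ∫⁻ l in {l : ℝ | l ≠ 0},
      ENNReal.ofReal
        (‖((|l| : ℝ) : ℂ) * ∫ x : ℝ × ℝ, (starRingEnd ℂ) (f x) * f (l • x)‖ * |l|⁻¹) < ⊤ := by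
  obtain ⟨M, hM⟩ : ∃ M, ∀ x, ‖f x‖ ≤ M := ⟨_, f.norm_le_seminorm ℝ⟩
  have majorant : Integrable fun l : ℝ => 2 * (M * ∫ x, ‖f x‖) * (1 + l ^ 2)⁻¹ :=
    integrable_inv_one_add_sq.const_mul _
  refine lt_of_le_of_lt ?_ (majorant.integrableOn (s := {l : ℝ | l ≠ 0})).lintegral_lt_top
  refine setLIntegral_mono' (measurableSet_singleton 0).compl fun l hl => ?_
  apply ENNReal.ofReal_le_ofReal
  have hl' : |l| ≠ 0 := abs_ne_zero.mpr hl
  rw [norm_mul, Complex.norm_real, Real.norm_eq_abs, abs_abs, mul_right_comm,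
    mul_inv_cancel₀ hl', one_mul]
  exact norm_integral_conj_mul_comp_smul_le f.integrable hM hl
end

section
/- Let f : ℝ² → ℂ be a continuous function with compact support contained in ℝ²∖{0}. Then for every x ∈ ℝ², x ≠ 0, the function t ↦ f(t•x + ‖x‖⁻²•(−x₂,x₁)) is integrable on ℝ, and the function I_w f : x ↦ ∫_ℝ f(t•x + ‖x‖⁻²•(−x₂,x₁)) dt is continuous on ℝ²∖{0}. (That is, the standard intertwining integral I_w maps C_c(G/N) into C(G/N).) -/
open MeasureTheory

/-- The orbit point `t • x + ‖x‖⁻² • w x`, where `w (x₁, x₂) = (-x₂, x₁)` and `‖x‖` is the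
Euclidean norm. -/
noncomputable def intertwiningPoint (x : ℝ × ℝ) (t : ℝ) : ℝ × ℝ :=
  t • x + ((x.1 ^ 2 + x.2 ^ 2)⁻¹ : ℝ) • ((-x.2, x.1) : ℝ × ℝ)

lemma norm_sq_le_sq_add_sq (x : ℝ × ℝ) : ‖x‖ ^ 2 ≤ x.1 ^ 2 + x.2 ^ 2 := by
  rw [Prod.norm_def, Real.norm_eq_abs, Real.norm_eq_abs]
  rcases max_cases |x.1| |x.2| with h | h <;> rw [h.1, sq_abs] <;>
    nlinarith [sq_nonneg x.1, sq_nonneg x.2]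

lemma abs_mul_norm_le (x : ℝ × ℝ) (t : ℝ) : |t| * ‖x‖ ≤ 2 * ‖intertwiningPoint x t‖ := by
  rcases eq_or_ne x 0 with rfl | hx
  · simp
  have hpos : 0 < ‖x‖ := norm_pos_iff.mpr hx
  set y := intertwiningPoint x t with hy
  have inner_eq : t * (x.1 ^ 2 + x.2 ^ 2) = x.1 * y.1 + x.2 * y.2 := by
    simp only [hy, intertwiningPoint, Prod.fst_add, Prod.snd_add, Prod.smul_fst, Prod.smul_snd,
      smul_eq_mul]
    ring
  have inner_le : |x.1 * y.1 + x.2 * y.2| ≤ 2 * ‖x‖ * ‖y‖ := by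
    have h₁ : |x.1 * y.1| ≤ ‖x‖ * ‖y‖ := by
      rw [abs_mul]
      exact mul_le_mul (norm_fst_le x) (norm_fst_le y) (abs_nonneg _) (norm_nonneg _)
    have h₂ : |x.2 * y.2| ≤ ‖x‖ * ‖y‖ := by
      rw [abs_mul]
      exact mul_le_mul (norm_snd_le x) (norm_snd_le y) (abs_nonneg _) (norm_nonneg _)
    linarith [abs_add_le (x.1 * y.1) (x.2 * y.2)]
  have hq := norm_sq_le_sq_add_sq x
  rw [← inner_eq, abs_mul, abs_of_nonneg ((sq_nonneg _).trans hq)] at inner_le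
  have := mul_le_mul_of_nonneg_left hq (abs_nonneg t)
  exact le_of_mul_le_mul_right (by linarith) hpos

lemma continuousOn_intertwiningPoint :
    ContinuousOn (Function.uncurry intertwiningPoint) ({x : ℝ × ℝ | x ≠ 0} ×ˢ Set.univ) := by
  have hq : ∀ p ∈ {x : ℝ × ℝ | x ≠ 0} ×ˢ (Set.univ : Set ℝ), p.1.1 ^ 2 + p.1.2 ^ 2 ≠ 0 :=
    fun p hp => ((pow_pos (norm_pos_iff.mpr hp.1) 2).trans_le (norm_sq_le_sq_add_sq p.1)).ne'
  unfold Function.uncurry intertwiningPoint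
  fun_prop (disch := exact hq)

/-- If `f` has compact support, `t ↦ f (intertwiningPoint x t)` vanishes outside a compact set
that is uniform for `x` bounded away from the origin. -/
lemma exists_isCompact_forall_intertwiningPoint_eq_zero {f : ℝ × ℝ → ℂ}
    (hcs : HasCompactSupport f) {c : ℝ} (hc : 0 < c) :
    ∃ k : Set ℝ, IsCompact k ∧
      ∀ x : ℝ × ℝ, ∀ t : ℝ, c ≤ ‖x‖ → t ∉ k → f (intertwiningPoint x t) = 0 := by
  obtain ⟨R, hR⟩ := hcs.isCompact.isBounded.exists_norm_le
  refine ⟨Metric.closedBall 0 (2 * R / c), isCompact_closedBall _ _, fun x t hx ht => ?_⟩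
  by_contra hne
  refine ht ?_
  rw [mem_closedBall_zero_iff, Real.norm_eq_abs, le_div_iff₀ hc]
  calc |t| * c ≤ |t| * ‖x‖ := by gcongr
    _ ≤ 2 * ‖intertwiningPoint x t‖ := abs_mul_norm_le x t
    _ ≤ 2 * R := by gcongr; exact hR _ (subset_tsupport f hne)

/-- For `f` continuous with compact support contained in `ℝ²∖{0}`, the standard
intertwining integral `I_w f(x) = ∫_ℝ f(t•x + ‖x‖⁻²•(-x₂,x₁)) dt` is absolutely
convergent for every `x ≠ 0` and defines a continuous function on `ℝ²∖{0}`. -/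
theorem stmt_11 (f : ℝ × ℝ → ℂ) (hf : Continuous f) (hcs : HasCompactSupport f)
    (hsupp : tsupport f ⊆ {y : ℝ × ℝ | y ≠ 0}) :
    (∀ x : ℝ × ℝ, x ≠ 0 →
      Integrable (fun t : ℝ =>
        f (t • x + ((x.1 ^ 2 + x.2 ^ 2)⁻¹ : ℝ) • ((-x.2, x.1) : ℝ × ℝ)))) ∧
    ContinuousOn
      (fun x : ℝ × ℝ =>
        ∫ t : ℝ, f (t • x + ((x.1 ^ 2 + x.2 ^ 2)⁻¹ : ℝ) • ((-x.2, x.1) : ℝ × ℝ)))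
      {x : ℝ × ℝ | x ≠ 0} := by
  change (∀ x : ℝ × ℝ, x ≠ 0 → Integrable (fun t : ℝ => f (intertwiningPoint x t))) ∧
    ContinuousOn (fun x : ℝ × ℝ => ∫ t : ℝ, f (intertwiningPoint x t)) {x : ℝ × ℝ | x ≠ 0}
  constructor
  · intro x hx
    obtain ⟨k, hk, hzero⟩ :=
      exists_isCompact_forall_intertwiningPoint_eq_zero hcs (norm_pos_iff.mpr hx)
    refine Continuous.integrable_of_hasCompactSupport ?_
      (HasCompactSupport.intro hk fun t ht => hzero x t le_rfl ht)
    unfold intertwiningPoint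
    fun_prop
  · intro x₀ hx₀
    have hpos : 0 < ‖x₀‖ := norm_pos_iff.mpr hx₀
    obtain ⟨k, hk, hzero⟩ :=
      exists_isCompact_forall_intertwiningPoint_eq_zero hcs (half_pos hpos)
    have hopen : IsOpen {x : ℝ × ℝ | ‖x₀‖ / 2 < ‖x‖} := isOpen_lt continuous_const continuous_norm
    have hsub : {x : ℝ × ℝ | ‖x₀‖ / 2 < ‖x‖} ⊆ {x | x ≠ 0} :=
      fun x hx => norm_pos_iff.mp ((half_pos hpos).trans hx)
    have hcont : ContinuousOn (fun x : ℝ × ℝ => ∫ t : ℝ, f (intertwiningPoint x t))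
        {x : ℝ × ℝ | ‖x₀‖ / 2 < ‖x‖} :=
      continuousOn_integral_of_compact_support hk
        (hf.comp_continuousOn
          (continuousOn_intertwiningPoint.mono (Set.prod_mono hsub Set.Subset.rfl)))
        fun x t hx ht => hzero x t hx.le ht
    exact (hcont.continuousAt (hopen.mem_nhds (half_lt_self hpos))).continuousWithinAt
end

section
/- Let f : ℝ² → ℂ be a continuous function with compact support contained in ℝ²∖{0}. Then for every g ∈ SL(2,ℝ) and every x ∈ ℝ², x ≠ 0: ∫_ℝ f( g⁻¹·(t•x + ‖x‖⁻²•w(x)) ) dt = ∫_ℝ f( t•(g⁻¹·x) + ‖g⁻¹·x‖⁻²•w(g⁻¹·x) ) dt, where w(x₁,x₂) = (−x₂,x₁) and g·x denotes matrix–vector multiplication. (This is the SL(2,ℝ)-equivariance of the standard intertwining integral I_w on C_c(G/N).) -/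
open MeasureTheory

/-- If `det A = 1`, then `A` maps the line `t ↦ t • x + ‖x‖⁻² • w x` to the line
`t ↦ t • y + ‖y‖⁻² • w y` with `y = A x`, up to a translation of the parameter. -/
theorem SL2Ract_line (A : Matrix (Fin 2) (Fin 2) ℝ) (hA : A.det = 1) (x : ℝ × ℝ) (hx : x ≠ 0) :
    ∃ c : ℝ, ∀ t : ℝ,
      SL2Ract A (t • x + ((x.1 ^ 2 + x.2 ^ 2)⁻¹ : ℝ) • ((-x.2, x.1) : ℝ × ℝ)) =
        (t + c) • SL2Ract A x +
          (((SL2Ract A x).1 ^ 2 + (SL2Ract A x).2 ^ 2)⁻¹ : ℝ) •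
            ((-(SL2Ract A x).2, (SL2Ract A x).1) : ℝ × ℝ) := by
  obtain ⟨x₁, x₂⟩ := x
  rw [Matrix.det_fin_two] at hA
  simp only [SL2Ract]
  generalize A 0 0 = a at *
  generalize A 0 1 = b at *
  generalize A 1 0 = c at *
  generalize A 1 1 = d at *
  have sq_add_sq_ne {p q : ℝ} (h : ¬(p = 0 ∧ q = 0)) : p ^ 2 + q ^ 2 ≠ 0 := fun h0 =>
    h ⟨by nlinarith [sq_nonneg p, sq_nonneg q], by nlinarith [sq_nonneg p, sq_nonneg q]⟩
  have hn : x₁ ^ 2 + x₂ ^ 2 ≠ 0 := sq_add_sq_ne fun h => hx (by simp [h.1, h.2])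
  obtain ⟨y₁, hy₁⟩ : ∃ y₁, y₁ = a * x₁ + b * x₂ := ⟨_, rfl⟩
  obtain ⟨y₂, hy₂⟩ : ∃ y₂, y₂ = c * x₁ + d * x₂ := ⟨_, rfl⟩
  have hx₁ : x₁ = d * y₁ - b * y₂ := by rw [hy₁, hy₂]; linear_combination -x₁ * hA
  have hx₂ : x₂ = a * y₂ - c * y₁ := by rw [hy₁, hy₂]; linear_combination -x₂ * hA
  have hm : y₁ ^ 2 + y₂ ^ 2 ≠ 0 := sq_add_sq_ne fun h => hn (by simp [hx₁, hx₂, h.1, h.2])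
  have hdet : y₁ * (d * x₁ - c * x₂) - y₂ * (b * x₁ - a * x₂) = x₁ ^ 2 + x₂ ^ 2 := by
    rw [hy₁, hy₂]; linear_combination (x₁ ^ 2 + x₂ ^ 2) * hA
  refine ⟨(y₁ * (b * x₁ - a * x₂) + y₂ * (d * x₁ - c * x₂)) /
    ((x₁ ^ 2 + x₂ ^ 2) * (y₁ ^ 2 + y₂ ^ 2)), fun t => ?_⟩
  simp only [Prod.smul_mk, Prod.mk_add_mk, smul_eq_mul, ← hy₁, ← hy₂, Prod.mk.injEq]
  generalize hN : x₁ ^ 2 + x₂ ^ 2 = N at *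
  generalize hM : y₁ ^ 2 + y₂ ^ 2 = M at *
  constructor
  · field_simp
    linear_combination (-(t * M * N)) * hy₁ - y₂ * hdet - (b * x₁ - a * x₂) * hM
  · field_simp
    linear_combination (-(t * M * N)) * hy₂ + y₁ * hdet - (d * x₁ - c * x₂) * hM

/-- `SL(2,ℝ)`-equivariance of the standard intertwining integral on `C_c(G/N)`: for `f`
continuous with compact support contained in `ℝ²∖{0}`, `g ∈ SL(2,ℝ)` and `x ≠ 0`,
`∫_ℝ f(g⁻¹·(t•x + ‖x‖⁻²•w(x))) dt = ∫_ℝ f(t•(g⁻¹·x) + ‖g⁻¹·x‖⁻²•w(g⁻¹·x)) dt`,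
where `w(x₁,x₂) = (-x₂,x₁)`. -/
theorem stmt_12 (f : ℝ × ℝ → ℂ) (hf : Continuous f) (hcs : HasCompactSupport f)
    (hsupp : tsupport f ⊆ {y : ℝ × ℝ | y ≠ 0})
    (g : Matrix.SpecialLinearGroup (Fin 2) ℝ) (x : ℝ × ℝ) (hx : x ≠ 0) :
    ∫ t : ℝ, f (SL2Ract (↑g⁻¹)
        (t • x + ((x.1 ^ 2 + x.2 ^ 2)⁻¹ : ℝ) • ((-x.2, x.1) : ℝ × ℝ))) =
      ∫ t : ℝ, f (t • SL2Ract (↑g⁻¹) x +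
        (((SL2Ract (↑g⁻¹) x).1 ^ 2 + (SL2Ract (↑g⁻¹) x).2 ^ 2)⁻¹ : ℝ) •
          ((-(SL2Ract (↑g⁻¹) x).2, (SL2Ract (↑g⁻¹) x).1) : ℝ × ℝ)) := by
  obtain ⟨c, hc⟩ := SL2Ract_line (↑g⁻¹) (g⁻¹).det_coe x hx
  simp only [hc]
  exact integral_add_right_eq_self (fun t : ℝ => f (t • SL2Ract (↑g⁻¹) x + _)) c
end

section
/- Let f : ℝ² → ℂ be a continuous function with compact support contained in ℝ²∖{0}. Then for every nonzero real number l and every x ∈ ℝ², x ≠ 0: |l|⁻¹ · ∫_ℝ f( l⁻¹•(t•x + ‖x‖⁻²•w(x)) ) dt = |l| · ∫_ℝ f( t•(l•x) + ‖l•x‖⁻²•w(l•x) ) dt, where w(x₁,x₂) = (−x₂,x₁). (This expresses the relation I_w(f.l) = I_w(f)._w l between the two C*(L)-module structures, where f.l = |l|⁻¹ f(l⁻¹ ·) and h._w l = |l| h(l ·).) -/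
open MeasureTheory

/-- The relation `I_w(f.l) = I_w(f)._w l` between the two `C*(L)`-module structures on the
universal principal series: for `f` continuous with compact support contained in `ℝ²∖{0}`,
`l ≠ 0` in `ℝ` and `x ≠ 0` in `ℝ²`,
`|l|⁻¹ ∫_ℝ f(l⁻¹•(t•x + ‖x‖⁻²•w(x))) dt = |l| ∫_ℝ f(t•(l•x) + ‖l•x‖⁻²•w(l•x)) dt`,
where `w(x₁,x₂) = (-x₂,x₁)`. -/
theorem stmt_13 (f : ℝ × ℝ → ℂ) (hf : Continuous f) (hcs : HasCompactSupport f)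
    (hsupp : tsupport f ⊆ {y : ℝ × ℝ | y ≠ 0}) (l : ℝ) (hl : l ≠ 0)
    (x : ℝ × ℝ) (hx : x ≠ 0) :
    ((|l|⁻¹ : ℝ) : ℂ) *
        ∫ t : ℝ, f (l⁻¹ • (t • x + ((x.1 ^ 2 + x.2 ^ 2)⁻¹ : ℝ) • ((-x.2, x.1) : ℝ × ℝ))) =
      ((|l| : ℝ) : ℂ) *
        ∫ t : ℝ, f (t • (l • x) +
          (((l • x).1 ^ 2 + (l • x).2 ^ 2)⁻¹ : ℝ) •
            ((-(l • x).2, (l • x).1) : ℝ × ℝ)) := by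
  set g : ℝ → ℂ := fun s =>
    f (s • x + (l⁻¹ * (x.1 ^ 2 + x.2 ^ 2)⁻¹) • ((-x.2, x.1) : ℝ × ℝ)) with hg
  have hleft : ∀ t : ℝ,
      f (l⁻¹ • (t • x + ((x.1 ^ 2 + x.2 ^ 2)⁻¹ : ℝ) • ((-x.2, x.1) : ℝ × ℝ))) = g (l⁻¹ * t) := by
    intro t
    simp only [hg, smul_add, smul_smul]
  have hnorm : ((l * x.1) ^ 2 + (l * x.2) ^ 2)⁻¹ * l = l⁻¹ * (x.1 ^ 2 + x.2 ^ 2)⁻¹ := by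
    rw [mul_pow, mul_pow, ← mul_add, mul_inv]
    field_simp
  have hright : ∀ t : ℝ,
      f (t • (l • x) + (((l • x).1 ^ 2 + (l • x).2 ^ 2)⁻¹ : ℝ) •
        ((-(l • x).2, (l • x).1) : ℝ × ℝ)) = g (l * t) := by
    intro t
    have hw : ((-(l • x).2, (l • x).1) : ℝ × ℝ) = l • ((-x.2, x.1) : ℝ × ℝ) := by
      ext <;> simp
    rw [hw, smul_smul, smul_smul, Prod.smul_fst, Prod.smul_snd, smul_eq_mul, smul_eq_mul, hnorm,
      mul_comm t l]
  have habs : ((|l| : ℝ) : ℂ) ≠ 0 := by exact_mod_cast abs_ne_zero.mpr hl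
  simp only [hleft, hright, Measure.integral_comp_mul_left, inv_inv, abs_inv, Complex.real_smul,
    Complex.ofReal_inv]
  rw [inv_mul_cancel_left₀ habs, mul_inv_cancel_left₀ habs]
end
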